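/- arXiv:1706.06708 — 4 statements merged into one kernel-verified Lean document; each statement's English description precedes it below -/
import Mathlib

section
/- For all i, i′ ∈ {1, …, n}, the permutations bᵢ and b_{i′} of S commute: bᵢ · b_{i′} = b_{i′} · bᵢ. -/
namespace RSq

def I (h : ℕ) : Type := {i : ℤ // i ≠ 0 ∧ |i| ≤ (h : ℤ)}

instance (h : ℕ) : DecidableEq (I h) :=
  inferInstanceAs (DecidableEq {i : ℤ // i ≠ 0 ∧ |i| ≤ (h : ℤ)})

instance (h : ℕ) : Neg (I h) :=
  ⟨fun i => ⟨-i.1, neg_ne_zero.mpr i.2.1, by rw [abs_neg]; exact i.2.2⟩⟩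

@[simp] theorem I.neg_neg {h : ℕ} (i : I h) : -(-i) = i :=
  Subtype.ext (by show -(-i.1) = i.1; exact _root_.neg_neg i.1)

abbrev S (h : ℕ) : Type := I h × I h × (ZMod 2 × ZMod 2)

@[simp] theorem zmod2_add_one_one (ε : ZMod 2) : ε + 1 + 1 = ε := by revert ε; decide

/-- Column move: flips column `j`. -/
def X {h : ℕ} (j : I h) : Equiv.Perm (S h) :=
  Function.Involutive.toPerm
    (fun s => if s.1 = j then (s.1, -s.2.1, (s.2.2.1 + 1, s.2.2.2)) else s)
    (by
      rintro ⟨c, r, ε₁, ε₂⟩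
      by_cases hc : c = j <;> simp [hc])

/-- Row move: flips row `i`. -/
def Y {h : ℕ} (i : I h) : Equiv.Perm (S h) :=
  Function.Involutive.toPerm
    (fun s => if s.2.1 = i then (-s.1, s.2.1, (s.2.2.1, s.2.2.2 + 1)) else s)
    (by
      rintro ⟨c, r, ε₁, ε₂⟩
      by_cases hr : r = i <;> simp [hr])

/-- The side-length parameter: `h = max m n + 2n`. -/
abbrev hS (n m : ℕ) : ℕ := max m n + 2 * n

def bit {m : ℕ} (w : Fin m → Bool) (c : ℤ) : Bool :=
  if hc : 1 ≤ c ∧ c ≤ (m : ℤ) then w ⟨(c - 1).toNat, by omega⟩ else false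

def colIdx {n m : ℕ} (j : Fin m) : I (hS n m) :=
  ⟨((j : ℕ) : ℤ) + 1, by
    have hj : (j : ℕ) < m := j.isLt
    have hm : m ≤ hS n m := le_trans (le_max_left m n) (Nat.le_add_right _ _)
    constructor
    · omega
    · rw [abs_of_nonneg (by omega)]; omega⟩

def rowIdx {n m : ℕ} (i : Fin n) : I (hS n m) :=
  ⟨((i : ℕ) : ℤ) + 1, by
    have hi : (i : ℕ) < n := i.isLt
    have hn : n ≤ hS n m := le_trans (le_max_right m n) (Nat.le_add_right _ _)
    constructor
    · omega
    · rw [abs_of_nonneg (by omega)]; omega⟩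

/-- `aᵢ := (X 1)^{lᵢ(1)} ⋯ (X m)^{lᵢ(m)}`. -/
def a {n m : ℕ} (l : Fin n → Fin m → Bool) (i : Fin n) : Equiv.Perm (S (hS n m)) :=
  ((List.finRange m).map (fun j => X (colIdx (n := n) j) ^ (if l i j then 1 else 0))).prod

/-- `bᵢ := aᵢ⁻¹ · (Y i) · aᵢ`. -/
def b {n m : ℕ} (l : Fin n → Fin m → Bool) (i : Fin n) : Equiv.Perm (S (hS n m)) :=
  (a l i)⁻¹ * Y (rowIdx (m := m) i) * a l i

/-- `t := a₁ · b₁ · b₂ ⋯ bₙ`. -/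
def t {n m : ℕ} (hn : 0 < n) (l : Fin n → Fin m → Bool) : Equiv.Perm (S (hS n m)) :=
  a l ⟨0, hn⟩ * ((List.finRange n).map (b l)).prod


theorem X_apply {h : ℕ} (j : I h) (s : S h) :
    X j s = if s.1 = j then (s.1, -s.2.1, (s.2.2.1 + 1, s.2.2.2)) else s :=
  rfl

theorem Y_apply {h : ℕ} (i : I h) (s : S h) :
    Y i s = if s.2.1 = i then (-s.1, s.2.1, (s.2.2.1, s.2.2.2 + 1)) else s :=
  rfl

theorem X_row_eq_or_eq_neg {h : ℕ} (j : I h) (s : S h) :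
    (X j s).2.1 = s.2.1 ∨ (X j s).2.1 = -s.2.1 := by
  by_cases hc : s.1 = j <;> simp [X_apply, hc]

theorem Y_apply_of_ne {h : ℕ} {i : I h} {s : S h} (hs : s.2.1 ≠ i) : Y i s = s := by
  rw [Y_apply, if_neg hs]

theorem list_prod_row_eq_or_eq_neg {h : ℕ} (L : List (Equiv.Perm (S h)))
    (hL : ∀ f ∈ L, ∀ s, (f s).2.1 = s.2.1 ∨ (f s).2.1 = -s.2.1) (s : S h) :
    (L.prod s).2.1 = s.2.1 ∨ (L.prod s).2.1 = -s.2.1 := by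
  induction L with
  | nil => simp
  | cons f L ih =>
    rw [List.prod_cons, Equiv.Perm.mul_apply]
    rcases hL f (by simp) (L.prod s) with hf | hf <;>
      rcases ih (fun g hg => hL g (List.mem_cons_of_mem f hg)) with hg | hg <;>
        simp [hf, hg]

theorem a_row_eq_or_eq_neg {n m : ℕ} (l : Fin n → Fin m → Bool) (i : Fin n)
    (s : S (hS n m)) : (a l i s).2.1 = s.2.1 ∨ (a l i s).2.1 = -s.2.1 := by
  refine list_prod_row_eq_or_eq_neg _ (fun f hf s => ?_) s
  obtain ⟨j, -, rfl⟩ := List.mem_map.mp hf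
  by_cases hl : l i j
  · simpa [hl] using X_row_eq_or_eq_neg (colIdx j) s
  · simp [hl]

theorem b_apply_of_abs_row_ne {n m : ℕ} (l : Fin n → Fin m → Bool) (i : Fin n)
    {s : S (hS n m)} (hs : |s.2.1.1| ≠ (i : ℕ) + 1) : b l i s = s := by
  have hne : (a l i s).2.1 ≠ rowIdx (m := m) i := by
    intro hr
    have habs : |(a l i s).2.1.1| = |s.2.1.1| := by
      rcases a_row_eq_or_eq_neg l i s with h | h <;> rw [h]
      exact abs_neg _
    apply hs
    rw [← habs, hr]
    exact abs_of_nonneg (Int.natCast_nonneg (i + 1))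
  rw [b, Equiv.Perm.mul_apply, Equiv.Perm.mul_apply, Y_apply_of_ne hne]
  exact (a l i).symm_apply_apply s

theorem b_disjoint {n m : ℕ} (l : Fin n → Fin m → Bool) {i i' : Fin n} (hi : i ≠ i') :
    (b l i).Disjoint (b l i') := by
  intro s
  by_cases hs : |s.2.1.1| = (i : ℕ) + 1
  · right
    apply b_apply_of_abs_row_ne
    have := Fin.val_ne_of_ne hi
    omega
  · exact Or.inl (b_apply_of_abs_row_ne l i hs)

/-- the permutations `bᵢ` all commute. -/
theorem stmt_0 (n m : ℕ) (hn : 0 < n) (hm : 0 < m) (l : Fin n → Fin m → Bool)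
    (i i' : Fin n) :
    b l i * b l i' = b l i' * b l i := by
  rcases eq_or_ne i i' with rfl | hi
  · rfl
  · exact (b_disjoint l hi).commute

end RSq
end

section
/- Suppose the bitstrings l₁, …, lₙ are pairwise distinct and lₙ is the all-zeros bitstring. Suppose g₁, …, g_{k′} with k′ ≤ 2n − 1 are permutations of S, each equal to X j or Y i for some i, j ∈ I, such that in the configuration (g_{k′} ⋯ g₁ · t)(C₀) the top face is monochromatic, i.e. the map sending each (c, r) ∈ I × I to ε₁ + ε₂, where (g_{k′} ⋯ g₁ · t)⁻¹(c, r, (0, 0)) = (c′, r′, (ε₁, ε₂)), is constant. Then there is a bijection σ of {1, …, n} such that the Hamming distance between l_{σ(p)} and l_{σ(p+1)} equals 1 for every 1 ≤ p ≤ n − 1. -/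
namespace RSq

section Counting

theorem sum_countP_le {α : Type*} {n : ℕ} (φ : α → ℕ) (w : List α) :
    ∑ i : Fin n, w.countP (fun x => φ x = i.val) ≤ w.length := by
  induction w with
  | nil => simp
  | cons x w ih =>
    simp only [List.countP_cons, Finset.sum_add_distrib, List.length_cons]
    refine Nat.add_le_add ih ?_
    rw [← Finset.card_filter]
    refine Finset.card_le_one.2 fun i hi j hj => ?_
    simp only [Finset.mem_filter, decide_eq_true_eq] at hi hj
    exact Fin.ext (hi.2.symm.trans hj.2)

theorem exists_split_of_countP_eq_one {α : Type*} {p : α → Bool} {w : List α}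
    (h : w.countP p = 1) :
    ∃ u x v, w = u ++ x :: v ∧ p x = true ∧ (∀ y ∈ u, p y = false) ∧ ∀ y ∈ v, p y = false := by
  obtain ⟨x, hx, hpx⟩ := List.countP_pos_iff.1 (by omega : 0 < w.countP p)
  obtain ⟨u, v, rfl⟩ := List.append_of_mem hx
  simp only [List.countP_append, List.countP_cons, hpx, if_true] at h
  refine ⟨u, x, v, rfl, hpx, ?_, ?_⟩
  · simpa using List.countP_eq_zero.1 (by omega : u.countP p = 0)
  · simpa using List.countP_eq_zero.1 (by omega : v.countP p = 0)

/-- If `n` distinct points all lie on a walk `Q` with at most `n - 1` steps of length at most one,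
then the walk traverses them as a Hamiltonian path. -/
theorem exists_perm_of_walk {n m : ℕ} {l : Fin n → Fin m → Bool} (hl : Function.Injective l)
    (Q : ℕ → Fin m → Bool) (hQ : ∀ k, hammingDist (Q k) (Q (k + 1)) ≤ 1)
    (κ : Fin n → ℕ) (hκ : ∀ i, κ i < n) (hQκ : ∀ i, Q (κ i) = l i) :
    ∃ σ : Equiv.Perm (Fin n), ∀ (p : ℕ) (hp : p + 1 < n),
      hammingDist (l (σ ⟨p, by omega⟩)) (l (σ ⟨p + 1, hp⟩)) = 1 := by
  have hinj : Function.Injective fun i => (⟨κ i, hκ i⟩ : Fin n) := fun i j hij => by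
    apply hl
    rw [← hQκ i, ← hQκ j, Fin.mk.inj hij]
  set e : Equiv.Perm (Fin n) := Equiv.ofBijective _ (Finite.injective_iff_bijective.1 hinj) with he
  have hσ : ∀ p : Fin n, l (e.symm p) = Q p := fun p => by
    have h := congrArg Fin.val (e.apply_symm_apply p)
    rw [← hQκ, ← h]
    rfl
  refine ⟨e.symm, fun p hp => le_antisymm ?_ (Nat.one_le_iff_ne_zero.2 fun h => ?_)⟩
  · rw [hσ, hσ]
    exact hQ p
  · have := e.symm.injective (hl (hammingDist_eq_zero.1 h))
    simp at this

end Counting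

section Colorings

variable {h : ℕ}

theorem I.val_neg (c : I h) : (-c).1 = -c.1 := rfl

theorem I.ne_neg (c : I h) : c ≠ -c := fun hc => by
  have h1 := congrArg Subtype.val hc
  have h2 := c.2.1
  rw [I.val_neg] at h1
  omega

theorem I.neg_eq_iff (c d : I h) : -c = d ↔ c = -d :=
  ⟨fun hc => by rw [← hc, I.neg_neg], fun hc => by rw [hc, I.neg_neg]⟩

theorem I.natAbs_eq_iff (c d : I h) : c.1.natAbs = d.1.natAbs ↔ c = d ∨ c = -d := by
  rw [Int.natAbs_eq_natAbs_iff]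
  refine ⟨fun hc => hc.imp (fun e => Subtype.ext e) fun e => Subtype.ext e, fun hc => ?_⟩
  rcases hc with rfl | rfl
  · exact Or.inl rfl
  · exact Or.inr (I.val_neg d)

instance : LawfulBEq (I h ⊕ I h) where
  eq_of_beq {x y} hxy := by
    rcases x with x | x <;> rcases y with y | y
    · exact congrArg Sum.inl (eq_of_beq (α := I h) hxy)
    · exact absurd hxy Bool.false_ne_true
    · exact absurd hxy Bool.false_ne_true
    · exact congrArg Sum.inr (eq_of_beq (α := I h) hxy)
  rfl {x} := by
    rcases x with x | x <;> exact beq_self_eq_true (α := I h) x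

/-- The move flipping a column (`inl`) or a row (`inr`). -/
def move : I h ⊕ I h → Equiv.Perm (S h) := Sum.elim X Y

/-- The effect of a move on the colors of the top face. -/
def recolor (x : I h ⊕ I h) (f : I h → I h → ZMod 2) (c r : I h) : ZMod 2 :=
  match x with
  | .inl j => if c = j then f c (-r) + 1 else f c r
  | .inr i => if r = i then f (-c) r + 1 else f c r

/-- The colors of the top face after carrying out a word of moves, rightmost first. -/
def recolorWord (w : List (I h ⊕ I h)) (f : I h → I h → ZMod 2) : I h → I h → ZMod 2 :=
  w.foldr recolor f

/-- The permutation `p`, applied to the solved square, colors the top face by `f`. -/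
def HasColoring (p : Equiv.Perm (S h)) (f : I h → I h → ZMod 2) : Prop :=
  ∀ c r e₁ e₂, (p⁻¹ (c, r, (e₁, e₂))).2.2.1 + (p⁻¹ (c, r, (e₁, e₂))).2.2.2 = e₁ + e₂ + f c r

theorem HasColoring.one : HasColoring (1 : Equiv.Perm (S h)) fun _ _ => 0 := by
  intro c r e₁ e₂
  simp

theorem X_inv_apply (j c r : I h) (e₁ e₂ : ZMod 2) :
    (X j)⁻¹ (c, r, (e₁, e₂)) = if c = j then (c, -r, (e₁ + 1, e₂)) else (c, r, (e₁, e₂)) := rfl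

theorem X_apply_s4 (j c r : I h) (e₁ e₂ : ZMod 2) :
    X j (c, r, (e₁, e₂)) = if c = j then (c, -r, (e₁ + 1, e₂)) else (c, r, (e₁, e₂)) := rfl

theorem Y_inv_apply (i c r : I h) (e₁ e₂ : ZMod 2) :
    (Y i)⁻¹ (c, r, (e₁, e₂)) = if r = i then (-c, r, (e₁, e₂ + 1)) else (c, r, (e₁, e₂)) := rfl

theorem HasColoring.move_mul {p : Equiv.Perm (S h)} {f : I h → I h → ZMod 2}
    (hp : HasColoring p f) (x : I h ⊕ I h) : HasColoring (move x * p) (recolor x f) := by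
  intro c r e₁ e₂
  rw [mul_inv_rev, Equiv.Perm.mul_apply]
  cases x with
  | inl j =>
    simp only [move, recolor, Sum.elim_inl, X_inv_apply]
    split_ifs <;> rw [hp]
    ring
  | inr i =>
    simp only [move, recolor, Sum.elim_inr, Y_inv_apply]
    split_ifs <;> rw [hp]
    ring

theorem HasColoring.word_mul {p : Equiv.Perm (S h)} {f : I h → I h → ZMod 2}
    (hp : HasColoring p f) (w : List (I h ⊕ I h)) :
    HasColoring ((w.map move).prod * p) (recolorWord w f) := by
  induction w with
  | nil => simpa [recolorWord] using hp
  | cons x w ih =>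
    rw [List.map_cons, List.prod_cons, mul_assoc]
    exact ih.move_mul x

theorem zmod2_eq_one_of_ne_zero {e : ZMod 2} (he : e ≠ 0) : e = 1 := by
  revert e; decide

/-- In a row which is never flipped, only the parities of the column moves matter. -/
theorem recolorWord_of_row_fixed {w : List (I h ⊕ I h)} {r : I h} (hr : .inr r ∉ w)
    (hr' : .inr (-r) ∉ w) (f : I h → I h → ZMod 2) (c : I h) :
    recolorWord w f c r =
      if (w.count (.inl c) : ZMod 2) = 0 then f c r else f c (-r) + 1 := by
  induction w generalizing r with
  | nil => simp [recolorWord]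
  | cons x w ih =>
    simp only [List.mem_cons, not_or] at hr hr'
    have h1 := ih hr.2 hr'.2
    have h2 := ih (r := -r) hr'.2 (by rw [I.neg_neg]; exact hr.2)
    simp only [recolorWord, List.foldr_cons] at h1 h2 ⊢
    cases x with
    | inl j =>
      by_cases hj : c = j
      · subst hj
        simp only [recolor, if_true, h2, List.count_cons_self, I.neg_neg, Nat.cast_add,
          Nat.cast_one]
        generalize (w.count (.inl c) : ZMod 2) = e
        revert e
        generalize f c r = a, f c (-r) = b
        revert a b
        decide
      · rw [List.count_cons_of_ne (by simpa using Ne.symm hj)]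
        simp only [recolor, if_neg hj, h1]
    | inr i =>
      have hi : r ≠ i := fun e => hr.1 (by rw [e])
      rw [List.count_cons_of_ne (by simp)]
      simp only [recolor, if_neg hi, h1]

/-- In a column which is never flipped, only the parities of the row moves matter. -/
theorem recolorWord_of_col_fixed {w : List (I h ⊕ I h)} {c : I h} (hc : .inl c ∉ w)
    (hc' : .inl (-c) ∉ w) (f : I h → I h → ZMod 2) (r : I h) :
    recolorWord w f c r =
      if (w.count (.inr r) : ZMod 2) = 0 then f c r else f (-c) r + 1 := by
  induction w generalizing c with
  | nil => simp [recolorWord]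
  | cons x w ih =>
    simp only [List.mem_cons, not_or] at hc hc'
    have h1 := ih hc.2 hc'.2
    have h2 := ih (c := -c) hc'.2 (by rw [I.neg_neg]; exact hc.2)
    simp only [recolorWord, List.foldr_cons] at h1 h2 ⊢
    cases x with
    | inr j =>
      by_cases hj : r = j
      · subst hj
        simp only [recolor, if_true, h2, List.count_cons_self, I.neg_neg, Nat.cast_add,
          Nat.cast_one]
        generalize (w.count (.inr r) : ZMod 2) = e
        revert e
        generalize f c r = a, f (-c) r = b
        revert a b
        decide
      · rw [List.count_cons_of_ne (by simpa using Ne.symm hj)]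
        simp only [recolor, if_neg hj, h1]
    | inl i =>
      have hi : c ≠ i := fun e => hc.1 (by rw [e])
      rw [List.count_cons_of_ne (by simp)]
      simp only [recolor, if_neg hi, h1]

theorem exists_untouched {w : List (I h ⊕ I h)} {M : ℕ} (hw : w.length + M < h) :
    ∃ d : I h, M < d.1 ∧ .inl d ∉ w ∧ .inl (-d) ∉ w ∧ .inr d ∉ w ∧ .inr (-d) ∉ w := by
  let φ : I h ⊕ I h → ℕ := Sum.elim (fun c => c.1.natAbs) (fun c => c.1.natAbs)
  have hcard : (w.map φ).toFinset.card < (Finset.Ioc M h).card := by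
    have := List.toFinset_card_le (w.map φ)
    rw [List.length_map] at this
    rw [Nat.card_Ioc]
    omega
  obtain ⟨d, hd, hdw⟩ := Finset.exists_mem_notMem_of_card_lt_card hcard
  rw [Finset.mem_Ioc] at hd
  have key : ∀ x : I h ⊕ I h, φ x = d → x ∉ w := fun x hx hxw =>
    hdw (by rw [List.mem_toFinset, ← hx]; exact List.mem_map_of_mem hxw)
  refine ⟨⟨d, by omega, by rw [abs_of_nonneg (by omega)]; omega⟩, by simpa using hd.1,
    key _ (Int.natAbs_natCast d), key _ ((Int.natAbs_neg _).trans (Int.natAbs_natCast d)),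
    key _ (Int.natAbs_natCast d), key _ ((Int.natAbs_neg _).trans (Int.natAbs_natCast d))⟩

end Colorings

section Scramble

variable {n m : ℕ} {l : Fin n → Fin m → Bool}

theorem val_colIdx (j : Fin m) : (colIdx (n := n) j).1 = (j : ℤ) + 1 := rfl

theorem val_rowIdx (i : Fin n) : (rowIdx (m := m) i).1 = (i : ℤ) + 1 := rfl

theorem colIdx_injective : Function.Injective (colIdx (n := n) (m := m)) := fun i j hij => by
  have := congrArg Subtype.val hij
  rw [val_colIdx, val_colIdx] at this
  exact Fin.ext (by omega)

theorem rowIdx_injective : Function.Injective (rowIdx (n := n) (m := m)) := fun i j hij => by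
  have := congrArg Subtype.val hij
  rw [val_rowIdx, val_rowIdx] at this
  exact Fin.ext (by omega)

theorem rowIdx_ne_neg (i j : Fin n) : rowIdx (m := m) i ≠ -rowIdx j := fun hij => by
  have := congrArg Subtype.val hij
  rw [I.val_neg, val_rowIdx, val_rowIdx] at this
  omega

/-- The column `c` is flipped by `a l i`. -/
def Flips (l : Fin n → Fin m → Bool) (i : Fin n) (c : I (hS n m)) : Prop :=
  ∃ j, l i j = true ∧ colIdx j = c

theorem flips_colIdx (i : Fin n) (j : Fin m) : Flips l i (colIdx j) ↔ l i j = true :=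
  ⟨fun ⟨_, hk, hkj⟩ => colIdx_injective hkj ▸ hk, fun hj => ⟨j, hj, rfl⟩⟩

theorem not_flips_of_neg {i : Fin n} {c : I (hS n m)} (hc : c.1 < 0) : ¬ Flips l i c := by
  rintro ⟨j, -, rfl⟩
  rw [val_colIdx] at hc
  omega

theorem not_flips_of_lt {i : Fin n} {c : I (hS n m)} (hc : (m : ℤ) < c.1) : ¬ Flips l i c := by
  rintro ⟨j, -, rfl⟩
  rw [val_colIdx] at hc
  omega

theorem not_flips_neg_of_flips {i : Fin n} {c : I (hS n m)} (hc : Flips l i c) :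
    ¬ Flips l i (-c) := by
  obtain ⟨j, -, rfl⟩ := hc
  apply not_flips_of_neg
  rw [I.val_neg, val_colIdx]
  omega

open Classical in
theorem a_apply (i : Fin n) (c r : I (hS n m)) (e₁ e₂ : ZMod 2) :
    a l i (c, r, (e₁, e₂)) =
      if Flips l i c then (c, -r, (e₁ + 1, e₂)) else (c, r, (e₁, e₂)) := by
  have key : ∀ L : List (Fin m), L.Nodup →
      (L.map (fun j => X (colIdx (n := n) j) ^ (if l i j then 1 else 0))).prod (c, r, (e₁, e₂)) =
        if ∃ j ∈ L, l i j = true ∧ colIdx j = c then (c, -r, (e₁ + 1, e₂))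
        else (c, r, (e₁, e₂)) := by
    intro L hL
    induction L with
    | nil => simp
    | cons k L ih =>
      rw [List.nodup_cons] at hL
      rw [List.map_cons, List.prod_cons, Equiv.Perm.mul_apply, ih hL.2]
      simp only [List.mem_cons, exists_eq_or_imp]
      by_cases hk : l i k = true ∧ colIdx k = c
      · have : ¬ ∃ j ∈ L, l i j = true ∧ colIdx j = c := fun ⟨j, hj, _, hjc⟩ =>
          hL.1 (colIdx_injective (hjc.trans hk.2.symm) ▸ hj)
        rw [if_neg this, if_pos (Or.inl hk), if_pos hk.1, pow_one, X_apply_s4, if_pos hk.2.symm]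
      · simp only [hk, false_or]
        by_cases hlk : l i k = true
        · have hc : ¬ c = colIdx k := fun e => hk ⟨hlk, e.symm⟩
          rw [if_pos hlk, pow_one]
          split_ifs <;> rw [X_apply_s4, if_neg hc]
        · rw [if_neg hlk, pow_zero, Equiv.Perm.one_apply]
  refine (key (List.finRange m) (List.nodup_finRange m)).trans (if_congr ?_ rfl rfl)
  simp [Flips]

theorem a_mul_self (i : Fin n) : a l i * a l i = 1 := by
  ext1 ⟨c, r, e₁, e₂⟩
  rw [Equiv.Perm.mul_apply, a_apply i c r, Equiv.Perm.one_apply]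
  split_ifs with hc <;> rw [a_apply] <;> simp [hc]

theorem a_inv (i : Fin n) : (a l i)⁻¹ = a l i :=
  inv_eq_of_mul_eq_one_left (a_mul_self i)

open Classical in
/-- The effect of `a l i` on the colors of the top face. -/
noncomputable def recolorA (l : Fin n → Fin m → Bool) (i : Fin n)
    (f : I (hS n m) → I (hS n m) → ZMod 2) (c r : I (hS n m)) : ZMod 2 :=
  if Flips l i c then f c (-r) + 1 else f c r

theorem HasColoring.a_mul {p : Equiv.Perm (S (hS n m))} {f : I (hS n m) → I (hS n m) → ZMod 2}
    (hp : HasColoring p f) (i : Fin n) : HasColoring (a l i * p) (recolorA l i f) := by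
  intro c r e₁ e₂
  rw [mul_inv_rev, Equiv.Perm.mul_apply, a_inv, a_apply]
  unfold recolorA
  split_ifs <;> rw [hp]
  ring

open Classical in
/-- The colors of the top face after applying `b l i` for all `i` in `L`. -/
noncomputable def bColoring (l : Fin n → Fin m → Bool) (L : List (Fin n))
    (c r : I (hS n m)) : ZMod 2 :=
  if ∃ i ∈ L, rowIdx i = r ∧ ¬ Flips l i c ∧ ¬ Flips l i (-c) then 1 else 0

open Classical in
theorem bColoring_rowIdx {L : List (Fin n)} {i : Fin n} (hi : i ∈ L) (c : I (hS n m)) :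
    bColoring l L c (rowIdx i) = if Flips l i c ∨ Flips l i (-c) then 0 else 1 := by
  unfold bColoring
  have : (∃ k ∈ L, rowIdx (m := m) k = rowIdx i ∧ ¬ Flips l k c ∧ ¬ Flips l k (-c)) ↔
      ¬ (Flips l i c ∨ Flips l i (-c)) := by
    rw [not_or]
    exact ⟨fun ⟨k, _, hk, h⟩ => rowIdx_injective hk ▸ h, fun h => ⟨i, hi, rfl, h⟩⟩
  rw [if_congr this rfl rfl, ite_not]

theorem bColoring_eq_zero {L : List (Fin n)} {r : I (hS n m)} (hr : ∀ i ∈ L, rowIdx i ≠ r)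
    (c : I (hS n m)) : bColoring l L c r = 0 :=
  if_neg fun ⟨i, hi, hir, _⟩ => hr i hi hir

open Classical in
theorem bColoring_cons_of_ne {L : List (Fin n)} {i : Fin n} {r : I (hS n m)} (hr : rowIdx i ≠ r)
    (c : I (hS n m)) : bColoring l (i :: L) c r = bColoring l L c r := by
  exact if_congr (by simp [hr]) rfl rfl

theorem hasColoring_b_prod {L : List (Fin n)} (hL : L.Nodup) :
    HasColoring (L.map (b l)).prod (bColoring l L) := by
  induction L with
  | nil =>
    have : bColoring l [] = fun _ _ => 0 := by
      funext c r
      exact bColoring_eq_zero (by simp) c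
    rw [this]
    exact HasColoring.one
  | cons i L ih =>
    rw [List.nodup_cons] at hL
    have hrec : HasColoring (a l i * (move (.inr (rowIdx i)) * (a l i * (L.map (b l)).prod)))
        (recolorA l i (recolor (.inr (rowIdx i)) (recolorA l i (bColoring l L)))) :=
      (((ih hL.2).a_mul i).move_mul _).a_mul i
    have hperm : a l i * (move (.inr (rowIdx i)) * (a l i * (L.map (b l)).prod)) =
        ((i :: L).map (b l)).prod := by
      rw [List.map_cons, List.prod_cons, b, a_inv]
      simp only [move, Sum.elim_inr, mul_assoc]
    rw [hperm] at hrec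
    convert hrec using 1
    funext c r
    have h0 : ∀ c, bColoring l L c (rowIdx i) = 0 := bColoring_eq_zero fun k hk hki =>
      hL.1 (rowIdx_injective hki ▸ hk)
    have h0' : ∀ c, bColoring l L c (-rowIdx i) = 0 := bColoring_eq_zero fun k _ =>
      rowIdx_ne_neg k i
    have hne := rowIdx_ne_neg (m := m) i i
    have h2 : (1 : ZMod 2) + 1 = 0 := rfl
    by_cases hr : r = rowIdx i
    · subst hr
      rw [bColoring_rowIdx List.mem_cons_self]
      simp only [recolorA, recolor, h0, h0', I.neg_neg, if_true, if_neg hne.symm]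
      by_cases hc : Flips l i c <;> by_cases hc' : Flips l i (-c) <;> simp [hc, hc', h2]
    · rw [bColoring_cons_of_ne (Ne.symm hr)]
      by_cases hr' : r = -rowIdx i
      · subst hr'
        simp only [recolorA, recolor, h0, h0', I.neg_neg, if_true, if_neg hne.symm]
        by_cases hc : Flips l i c
        · have hc' := not_flips_neg_of_flips hc
          simp [hc, hc', h2]
        · simp [hc]
      · have hr'' : ¬ -r = rowIdx i := fun e => hr' (by rw [← e, I.neg_neg])
        simp only [recolorA, recolor, if_neg hr, if_neg hr'', I.neg_neg]
        by_cases hc : Flips l i c <;> simp [hc]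

theorem hasColoring_t (hn : 0 < n) :
    HasColoring (t hn l) (recolorA l ⟨0, hn⟩ (bColoring l (List.finRange n))) :=
  (hasColoring_b_prod (List.nodup_finRange n)).a_mul _

open Classical in
theorem recolorA_bColoring_of_ne {i₀ : Fin n} {r : I (hS n m)} (hr : ∀ i, rowIdx i ≠ r)
    (hr' : ∀ i, rowIdx i ≠ -r) (c : I (hS n m)) :
    recolorA l i₀ (bColoring l (List.finRange n)) c r = if Flips l i₀ c then 1 else 0 := by
  unfold recolorA
  rw [bColoring_eq_zero fun i _ => hr i, bColoring_eq_zero fun i _ => hr' i, zero_add]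

theorem recolorA_bColoring_rowIdx {i₀ : Fin n} (i : Fin n) {c : I (hS n m)}
    (hc : ∀ i, ¬ Flips l i c) (hc' : ∀ i, ¬ Flips l i (-c)) :
    recolorA l i₀ (bColoring l (List.finRange n)) c (rowIdx i) = 1 := by
  unfold recolorA
  rw [if_neg (hc i₀), bColoring_rowIdx (List.mem_finRange i), if_neg (not_or.2 ⟨hc i, hc' i⟩)]

theorem recolorA_bColoring_neg_rowIdx {i₀ : Fin n} (i : Fin n) {c : I (hS n m)}
    (hc : ∀ i, ¬ Flips l i c) :
    recolorA l i₀ (bColoring l (List.finRange n)) c (-rowIdx i) = 0 := by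
  unfold recolorA
  rw [if_neg (hc i₀), bColoring_eq_zero fun k _ => rowIdx_ne_neg k i]

open Classical in
/-- The parities of the moves in a short word turning the scrambled top face monochromatic. -/
theorem parities_of_monochromatic {i₀ : Fin n} {w : List (I (hS n m) ⊕ I (hS n m))}
    (hw : w.length < 2 * n) {v : ZMod 2}
    (hv : ∀ c r, recolorWord w (recolorA l i₀ (bColoring l (List.finRange n))) c r = v) :
    v = 0 ∧ (∀ c, (w.count (.inl c) : ZMod 2) = if Flips l i₀ c then 1 else 0) ∧
      ∀ i, (w.count (.inr (rowIdx i)) : ZMod 2) = 1 ∧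
        (w.count (.inr (-rowIdx i)) : ZMod 2) = 0 := by
  obtain ⟨d, hd, h1, h2, h3, h4⟩ :=
    exists_untouched (w := w) (M := max m n) (by unfold hS; omega)
  have hf : ∀ i, ¬ Flips l i d := fun i => not_flips_of_lt (by omega)
  have hf' : ∀ i, ¬ Flips l i (-d) := fun i => not_flips_of_neg (by rw [I.val_neg]; omega)
  have hr : ∀ i : Fin n, rowIdx i ≠ d := fun i e => by
    have := congrArg Subtype.val e
    rw [val_rowIdx] at this
    omega
  have hr' : ∀ i : Fin n, rowIdx i ≠ -d := fun i e => by
    have := congrArg Subtype.val e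
    rw [val_rowIdx, I.val_neg] at this
    omega
  have hr'' : ∀ i : Fin n, rowIdx i ≠ - -d := by rwa [I.neg_neg]
  have hv0 : v = 0 := by
    rw [← hv d d, recolorWord_of_row_fixed h3 h4, List.count_eq_zero.2 h1, Nat.cast_zero,
      if_pos rfl, recolorA_bColoring_of_ne hr hr', if_neg (hf i₀)]
  subst hv0
  refine ⟨rfl, fun c => ?_, fun i => ⟨?_, ?_⟩⟩
  · have h := hv c d
    rw [recolorWord_of_row_fixed h3 h4, recolorA_bColoring_of_ne hr hr',
      recolorA_bColoring_of_ne hr' hr''] at h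
    revert h
    generalize (w.count (.inl c) : ZMod 2) = e
    split_ifs <;> revert e <;> decide
  · have h := hv d (rowIdx i)
    rw [recolorWord_of_col_fixed h1 h2, recolorA_bColoring_rowIdx i hf hf'] at h
    exact zmod2_eq_one_of_ne_zero fun e => by simp [e] at h
  · have h := hv d (-rowIdx i)
    rw [recolorWord_of_col_fixed h1 h2, recolorA_bColoring_neg_rowIdx i hf,
      recolorA_bColoring_neg_rowIdx i hf'] at h
    by_contra e
    simp [e] at h

/-- If the rows `± rowIdx i` are flipped only once, then at that time the columns flipped so far
encode `l i`. -/
theorem parity_of_single_row {i₀ i : Fin n} {u v : List (I (hS n m) ⊕ I (hS n m))}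
    (hu : .inr (rowIdx i) ∉ u) (hu' : .inr (-rowIdx i) ∉ u)
    (hv : .inr (rowIdx i) ∉ v) (hv' : .inr (-rowIdx i) ∉ v)
    (h0 : ∀ c r, recolorWord (u ++ .inr (rowIdx i) :: v)
      (recolorA l i₀ (bColoring l (List.finRange n))) c r = 0) (j : Fin m)
    (hj : ((u ++ .inr (rowIdx i) :: v).count (.inl (colIdx j)) : ZMod 2) =
      if l i₀ j then 1 else 0)
    (hj' : ((u ++ .inr (rowIdx i) :: v).count (.inl (-colIdx j)) : ZMod 2) = 0) :
    ((v.count (.inl (colIdx j)) + v.count (.inl (-colIdx j)) : ℕ) : ZMod 2) +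
      (if l i₀ j then 1 else 0) = if l i j then 1 else 0 := by
  have hneg : ∀ k, ¬ Flips l k (-colIdx (n := n) j) := fun k => not_flips_of_neg (by
    rw [I.val_neg, val_colIdx]; omega)
  have hB : ∀ c, bColoring l (List.finRange n) c (-rowIdx i) = 0 :=
    bColoring_eq_zero fun k _ => rowIdx_ne_neg k i
  have hB₁ := bColoring_rowIdx (l := l) (List.mem_finRange i) (colIdx j)
  have hB₂ := bColoring_rowIdx (l := l) (List.mem_finRange i) (-colIdx j)
  simp only [I.neg_neg, flips_colIdx, hneg, or_false, false_or] at hB₁ hB₂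
  have hne := (rowIdx_ne_neg (m := m) i i).symm
  have hu'' : .inr (- -rowIdx i) ∉ u := by rwa [I.neg_neg]
  have hv'' : .inr (- -rowIdx i) ∉ v := by rwa [I.neg_neg]
  have e₁ := h0 (colIdx j) (rowIdx i)
  have e₂ := h0 (colIdx j) (-rowIdx i)
  have e₃ := h0 (-colIdx j) (rowIdx i)
  have e₄ := h0 (-colIdx j) (-rowIdx i)
  have happ : ∀ f, recolorWord (u ++ .inr (rowIdx i) :: v) f =
      recolorWord u (recolor (.inr (rowIdx i)) (recolorWord v f)) := fun f => by
    simp [recolorWord]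
  simp only [happ, recolorWord_of_row_fixed hu hu', recolorWord_of_row_fixed hu' hu'', recolor,
    if_true, if_neg hne, recolorWord_of_row_fixed hv hv', recolorWord_of_row_fixed hv' hv'',
    I.neg_neg, recolorA, flips_colIdx, hneg, if_false, hB, hB₁, hB₂] at e₁ e₂ e₃ e₄
  have hcount : ∀ c, (Sum.inr (rowIdx i) :: v).count (.inl c) = v.count (.inl c) := fun c =>
    List.count_cons_of_ne (by simp)
  simp only [List.count_append, hcount, Nat.cast_add] at hj hj' ⊢
  clear hcount happ h0 hB hB₁ hB₂ hneg
  generalize (u.count (.inl (colIdx j)) : ZMod 2) = p at *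
  generalize (u.count (.inl (-colIdx j)) : ZMod 2) = p' at *
  generalize (v.count (.inl (colIdx j)) : ZMod 2) = q at *
  generalize (v.count (.inl (-colIdx j)) : ZMod 2) = q' at *
  generalize l i₀ j = x at *
  generalize l i j = y at *
  clear hu hu' hu'' hv hv' hv'' hne
  revert p p' q q' x y
  decide

end Scramble

section Walk

variable {h : ℕ}

/-- The distance from the middle of the column that is flipped, zero for row moves. -/
def colAbs : I h ⊕ I h → ℕ := Sum.elim (fun c => c.1.natAbs) fun _ => 0

/-- The distance from the middle of the row that is flipped, zero for column moves. -/
def rowAbs : I h ⊕ I h → ℕ := Sum.elim (fun _ => 0) fun r => r.1.natAbs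

theorem rowAbs_eq_zero_of_colAbs_pos {x : I h ⊕ I h} (hx : 0 < colAbs x) : rowAbs x = 0 := by
  cases x <;> simp_all [colAbs, rowAbs]

theorem countP_colAbs (w : List (I h ⊕ I h)) (c : I h) :
    w.countP (fun x => colAbs x = c.1.natAbs) = w.count (.inl c) + w.count (.inl (-c)) := by
  induction w with
  | nil => simp
  | cons x w ih =>
    rw [List.countP_cons, List.count_cons, List.count_cons, ih]
    cases x with
    | inl d =>
      have hc := I.ne_neg c
      simp only [colAbs, Sum.elim_inl, decide_eq_true_eq, I.natAbs_eq_iff, beq_iff_eq,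
        Sum.inl.injEq]
      by_cases h1 : d = c
      · subst h1
        simp [hc]
        omega
      · by_cases h2 : d = -c <;> simp [h1, h2, hc.symm]
        omega
    | inr r =>
      have h0 : ¬ 0 = c.1.natAbs := fun e => c.2.1 (Int.natAbs_eq_zero.1 e.symm)
      simp [colAbs, h0]

theorem countP_rowAbs (w : List (I h ⊕ I h)) (r : I h) :
    w.countP (fun x => rowAbs x = r.1.natAbs) = w.count (.inr r) + w.count (.inr (-r)) := by
  induction w with
  | nil => simp
  | cons x w ih =>
    rw [List.countP_cons, List.count_cons, List.count_cons, ih]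
    cases x with
    | inr d =>
      have hc := I.ne_neg r
      simp only [rowAbs, Sum.elim_inr, decide_eq_true_eq, I.natAbs_eq_iff, beq_iff_eq,
        Sum.inr.injEq]
      by_cases h1 : d = r
      · subst h1
        simp [hc]
        omega
      · by_cases h2 : d = -r <;> simp [h1, h2, hc.symm]
        omega
    | inl c =>
      have h0 : ¬ 0 = r.1.natAbs := fun e => r.2.1 (Int.natAbs_eq_zero.1 e.symm)
      simp [rowAbs, h0]

/-- The bitstring obtained from `s` by flipping one bit for each column move in `w`. -/
def walk {m : ℕ} (s : Fin m → Bool) (w : List (I h ⊕ I h)) (j : Fin m) : Bool :=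
  decide ((w.countP (fun x => colAbs x = j.val + 1) : ZMod 2) + (if s j then 1 else 0) = 1)

theorem walk_filter {m : ℕ} (s : Fin m → Bool) (w : List (I h ⊕ I h)) :
    walk s (w.filter fun x => rowAbs x = 0) = walk s w := by
  funext j
  have : (w.filter fun x => rowAbs x = 0).countP (fun x => colAbs x = j.val + 1) =
      w.countP (fun x => colAbs x = j.val + 1) := by
    rw [List.countP_filter]
    refine List.countP_congr fun x _ => ?_
    simp only [Bool.and_eq_true, decide_eq_true_eq, and_iff_left_iff_imp]
    intro hx
    exact rowAbs_eq_zero_of_colAbs_pos (by omega)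
  unfold walk
  rw [this]

theorem hammingDist_walk_cons_le {m : ℕ} (s : Fin m → Bool) (x : I h ⊕ I h)
    (w : List (I h ⊕ I h)) : hammingDist (walk s (x :: w)) (walk s w) ≤ 1 := by
  have key : ∀ j, walk s (x :: w) j ≠ walk s w j → colAbs x = j.val + 1 := fun j hj => by
    by_contra hx
    exact hj (by simp [walk, hx])
  refine Finset.card_le_one.2 fun i hi j hj => ?_
  rw [Finset.mem_filter] at hi hj
  have h1 := key i hi.2
  have h2 := key j hj.2
  exact Fin.ext (by omega)

theorem hammingDist_walk_drop_le {m : ℕ} (s : Fin m → Bool) (w : List (I h ⊕ I h)) (k : ℕ) :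
    hammingDist (walk s (w.drop k)) (walk s (w.drop (k + 1))) ≤ 1 := by
  by_cases hk : k < w.length
  · rw [List.drop_eq_getElem_cons hk]
    exact hammingDist_walk_cons_le s _ _
  · rw [List.drop_eq_nil_of_le (by omega), List.drop_eq_nil_of_le (by omega), hammingDist_self]
    exact Nat.zero_le _

end Walk

section Main

variable {n m : ℕ} {l : Fin n → Fin m → Bool}

theorem natAbs_rowIdx (i : Fin n) : (rowIdx (m := m) i).1.natAbs = i.val + 1 := by
  rw [val_rowIdx]
  omega

theorem natAbs_colIdx (j : Fin m) : (colIdx (n := n) j).1.natAbs = j.val + 1 := by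
  rw [val_colIdx]
  omega

theorem exists_walk_eq_of_single_row {i₀ i : Fin n} {w : List (I (hS n m) ⊕ I (hS n m))}
    (hw : w.length < 2 * n)
    (h0 : ∀ c r, recolorWord w (recolorA l i₀ (bColoring l (List.finRange n))) c r = 0)
    (hi : w.countP (fun x => rowAbs x = i.val + 1) = 1) :
    ∃ k ≤ w.countP (fun x => rowAbs x = 0),
      walk (l i₀) ((w.filter fun x => rowAbs x = 0).drop k) = l i := by
  obtain ⟨-, hcol, hrow⟩ := parities_of_monochromatic hw h0
  obtain ⟨u, x, v, hwx, hx, hu, hv⟩ := exists_split_of_countP_eq_one hi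
  have hnot : ∀ L : List (I (hS n m) ⊕ I (hS n m)),
      (∀ y ∈ L, decide (rowAbs y = i.val + 1) = false) →
        .inr (rowIdx i) ∉ L ∧ .inr (-rowIdx i) ∉ L := by
    intro L hL
    refine ⟨fun hm => ?_, fun hm => ?_⟩
    · simpa [rowAbs, natAbs_rowIdx] using hL _ hm
    · simpa [rowAbs, I.val_neg, natAbs_rowIdx] using hL _ hm
  have hxi : x = .inr (rowIdx i) := by
    have hmem : .inr (rowIdx i) ∈ w := by
      by_contra hm
      have := (hrow i).1
      rw [List.count_eq_zero.2 hm] at this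
      simp at this
    rw [hwx, List.mem_append, List.mem_cons] at hmem
    rcases hmem with hm | hm | hm
    · exact absurd hm (hnot u hu).1
    · exact hm.symm
    · exact absurd hm (hnot v hv).1
  subst hxi
  subst hwx
  refine ⟨(u.filter fun x => rowAbs x = 0).length, ?_, ?_⟩
  · rw [List.countP_append, ← List.countP_eq_length_filter]
    exact Nat.le_add_right _ _
  · have hfalse : decide (rowAbs (.inr (rowIdx (m := m) i)) = 0) = false := by
      simp [rowAbs, natAbs_rowIdx]
    rw [List.filter_append, List.drop_left, List.filter_cons_of_neg (by simp [hfalse]),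
      walk_filter]
    funext j
    have hneg : ¬ Flips l i₀ (-colIdx (n := n) j) := not_flips_of_neg (by
      rw [I.val_neg, val_colIdx]; omega)
    have := parity_of_single_row (hnot u hu).1 (hnot u hu).2 (hnot v hv).1 (hnot v hv).2 h0 j
      (by rw [hcol]; simp only [flips_colIdx]) (by rw [hcol, if_neg hneg])
    unfold walk
    rw [← natAbs_colIdx (n := n) j, countP_colAbs, this]
    cases l i j <;> simp

theorem exists_hamiltonian_path_of_monochromatic {i₀ : Fin n} (hl : Function.Injective l)
    {w : List (I (hS n m) ⊕ I (hS n m))} (hw : w.length < 2 * n) {v : ZMod 2}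
    (hv : ∀ c r, recolorWord w (recolorA l i₀ (bColoring l (List.finRange n))) c r = v) :
    ∃ σ : Equiv.Perm (Fin n), ∀ (p : ℕ) (hp : p + 1 < n),
      hammingDist (l (σ ⟨p, by omega⟩)) (l (σ ⟨p + 1, hp⟩)) = 1 := by
  obtain ⟨rfl, -, hrow⟩ := parities_of_monochromatic hw hv
  set cnt : Fin n → ℕ := fun i => w.countP fun x => rowAbs x = i.val + 1 with hcnt
  set K := w.countP fun x => rowAbs x = 0 with hK
  have hodd : ∀ i, cnt i = 1 ∨ 3 ≤ cnt i := fun i => by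
    have h1 : ((cnt i : ℕ) : ZMod 2) = 1 := by
      rw [hcnt]
      simp only
      rw [← natAbs_rowIdx (m := m) i, countP_rowAbs, Nat.cast_add, (hrow i).1, (hrow i).2,
        add_zero]
    rw [← Nat.cast_one, ZMod.natCast_eq_natCast_iff'] at h1
    omega
  have hex : ∀ i, ∃ k, cnt i = 1 → k ≤ K ∧
      walk (l i₀) ((w.filter fun x => rowAbs x = 0).drop k) = l i := fun i => by
    by_cases hi : cnt i = 1
    · obtain ⟨k, hk⟩ := exists_walk_eq_of_single_row hw hv hi
      exact ⟨k, fun _ => hk⟩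
    · exact ⟨0, fun h => absurd h hi⟩
  choose κ hκ using hex
  have hsum : K + ∑ i, cnt i ≤ w.length := by
    have := sum_countP_le (n := n + 1) rowAbs w
    rwa [Fin.sum_univ_succ] at this
  have hsingle : (Finset.univ.filter fun i => cnt i = 1).card ≤ K + 1 := by
    rw [← Finset.card_range (K + 1)]
    refine Finset.card_le_card_of_injOn κ (fun i hi => ?_) fun i hi j hj hij => ?_
    · have := (hκ i (by simpa using hi)).1
      simp only [Finset.coe_range, Set.mem_Iio]
      omega
    · apply hl
      rw [← (hκ i (by simpa using hi)).2, ← (hκ j (by simpa using hj)).2, hij]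
  have hlower : 3 * n ≤ ∑ i, cnt i + 2 * (Finset.univ.filter fun i => cnt i = 1).card := by
    rw [Finset.card_filter, Finset.mul_sum, ← Finset.sum_add_distrib]
    calc 3 * n = ∑ _i : Fin n, 3 := by simp [mul_comm]
      _ ≤ _ := Finset.sum_le_sum fun i _ => by
        rcases hodd i with h | h
        · simp [h]
        · omega
  have hcard : (Finset.univ.filter fun i => cnt i = 1).card = n := by
    have := Finset.card_filter_le Finset.univ fun i => cnt i = 1
    rw [Finset.card_univ, Fintype.card_fin] at this
    omega
  have hall : ∀ i, cnt i = 1 := by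
    have : (Finset.univ.filter fun i => cnt i = 1) = Finset.univ :=
      Finset.eq_univ_of_card _ (by rw [hcard, Fintype.card_fin])
    simpa using this
  exact exists_perm_of_walk hl _ (hammingDist_walk_drop_le (l i₀) _) κ
    (fun i => by have := (hκ i (hall i)).1; omega) fun i => (hκ i (hall i)).2

end Main

/-- a ≤ 2n−1 move sequence making the top face monochromatic yields a
Hamiltonian path through the bitstrings. -/
theorem stmt_4 (n m : ℕ) (hn : 0 < n) (hm : 0 < m) (l : Fin n → Fin m → Bool)
    (hdist : Function.Injective l)
    (hlast : l ⟨n - 1, by omega⟩ = fun _ => false)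
    (k' : ℕ) (hk : k' ≤ 2 * n - 1) (g : Fin k' → Equiv.Perm (S (hS n m)))
    (hmoves : ∀ q, (∃ j, g q = X j) ∨ (∃ i, g q = Y i))
    (hmono : ∃ v : ZMod 2, ∀ c r : I (hS n m),
      (((List.ofFn g).reverse.prod * t hn l)⁻¹
          (c, r, ((0 : ZMod 2), (0 : ZMod 2)))).2.2.1 +
        (((List.ofFn g).reverse.prod * t hn l)⁻¹
          (c, r, ((0 : ZMod 2), (0 : ZMod 2)))).2.2.2 = v) :
    ∃ σ : Equiv.Perm (Fin n), ∀ (p : ℕ) (hp : p + 1 < n),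
      hammingDist (l (σ ⟨p, by omega⟩)) (l (σ ⟨p + 1, hp⟩)) = 1 := by
  have hx : ∀ q, ∃ x, g q = move x := fun q => by
    rcases hmoves q with ⟨j, hj⟩ | ⟨i, hi⟩
    · exact ⟨.inl j, hj⟩
    · exact ⟨.inr i, hi⟩
  choose x hx using hx
  obtain ⟨v, hv⟩ := hmono
  have hg : (List.ofFn g).reverse = (List.ofFn x).reverse.map move := by
    rw [List.map_reverse, List.map_ofFn]
    congr 2
    exact funext hx
  refine exists_hamiltonian_path_of_monochromatic (i₀ := ⟨0, hn⟩) (v := v) hdist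
    (w := (List.ofFn x).reverse) (by rw [List.length_reverse, List.length_ofFn]; omega)
    fun c r => ?_
  rw [← hv c r, hg, ((hasColoring_t hn).word_mul _) c r 0 0, zero_add, zero_add]

end RSq
end

section
/- Let i ∈ {1, …, n}. Then: (1) for every j ∈ {1, …, m} with lᵢ(j) = 1, bᵢ sends the slot ((j, −(m+i), h), +z) to ((h, −j, m+i), +x) and sends the slot ((j, −(m+i), −h), −z) to ((−h, −j, m+i), −x); (2) bᵢ fixes every other surface slot whose direction is +z or −z. -/
namespace RC

/-- The six signed coordinate directions. -/
inductive Dir : Type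
  | xp | xn | yp | yn | zp | zn
  deriving DecidableEq

/-- Nonzero slice coordinates of absolute value at most `h`. -/
def I (h : ℕ) : Type := {i : ℤ // i ≠ 0 ∧ |i| ≤ (h : ℤ)}

instance (h : ℕ) : DecidableEq (I h) :=
  inferInstanceAs (DecidableEq {i : ℤ // i ≠ 0 ∧ |i| ≤ (h : ℤ)})

instance (h : ℕ) : Neg (I h) :=
  ⟨fun i => ⟨-i.1, neg_ne_zero.mpr i.2.1, by rw [abs_neg]; exact i.2.2⟩⟩

@[simp] theorem I.neg_neg {h : ℕ} (i : I h) : -(-i) = i :=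
  Subtype.ext (by show -(-i.1) = i.1; exact _root_.neg_neg i.1)

/-- Sticker slots of the cube: a cubie position together with a face direction. -/
abbrev S (h : ℕ) : Type := (I h × I h × I h) × Dir

/-- Rotation of directions by a clockwise `x` turn: fixes `±x`,
`+y ↦ −z ↦ −y ↦ +z ↦ +y`. -/
def rotX : Dir → Dir
  | .xp => .xp | .xn => .xn | .yp => .zn | .zn => .yn | .yn => .zp | .zp => .yp

def rotXi : Dir → Dir
  | .xp => .xp | .xn => .xn | .zn => .yp | .yn => .zn | .zp => .yn | .yp => .zp

/-- Rotation of directions by a clockwise `y` turn: fixes `±y`,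
`+z ↦ −x ↦ −z ↦ +x ↦ +z`. -/
def rotY : Dir → Dir
  | .yp => .yp | .yn => .yn | .zp => .xn | .xn => .zn | .zn => .xp | .xp => .zp

def rotYi : Dir → Dir
  | .yp => .yp | .yn => .yn | .xn => .zp | .zn => .xn | .xp => .zn | .zp => .xp

/-- Rotation of directions by a clockwise `z` turn: fixes `±z`,
`+x ↦ −y ↦ −x ↦ +y ↦ +x`. -/
def rotZ : Dir → Dir
  | .zp => .zp | .zn => .zn | .xp => .yn | .yn => .xn | .xn => .yp | .yp => .xp

def rotZi : Dir → Dir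
  | .zp => .zp | .zn => .zn | .yn => .xp | .xn => .yn | .yp => .xn | .xp => .yp

@[simp] theorem rotXi_rotX (d : Dir) : rotXi (rotX d) = d := by cases d <;> rfl
@[simp] theorem rotX_rotXi (d : Dir) : rotX (rotXi d) = d := by cases d <;> rfl
@[simp] theorem rotYi_rotY (d : Dir) : rotYi (rotY d) = d := by cases d <;> rfl
@[simp] theorem rotY_rotYi (d : Dir) : rotY (rotYi d) = d := by cases d <;> rfl
@[simp] theorem rotZi_rotZ (d : Dir) : rotZi (rotZ d) = d := by cases d <;> rfl
@[simp] theorem rotZ_rotZi (d : Dir) : rotZ (rotZi d) = d := by cases d <;> rfl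

/-- Clockwise quarter turn of the `x = v` slice (as seen from positive `x`). -/
def X {h : ℕ} (v : I h) : Equiv.Perm (S h) where
  toFun s := if s.1.1 = v then ((s.1.1, s.1.2.2, -s.1.2.1), rotX s.2) else s
  invFun s := if s.1.1 = v then ((s.1.1, -s.1.2.2, s.1.2.1), rotXi s.2) else s
  left_inv := by
    rintro ⟨⟨x, y, z⟩, d⟩
    by_cases hx : x = v <;> simp [hx]
  right_inv := by
    rintro ⟨⟨x, y, z⟩, d⟩
    by_cases hx : x = v <;> simp [hx]

/-- Clockwise quarter turn of the `y = v` slice (as seen from positive `y`). -/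
def Y {h : ℕ} (v : I h) : Equiv.Perm (S h) where
  toFun s := if s.1.2.1 = v then ((-s.1.2.2, s.1.2.1, s.1.1), rotY s.2) else s
  invFun s := if s.1.2.1 = v then ((s.1.2.2, s.1.2.1, -s.1.1), rotYi s.2) else s
  left_inv := by
    rintro ⟨⟨x, y, z⟩, d⟩
    by_cases hy : y = v <;> simp [hy]
  right_inv := by
    rintro ⟨⟨x, y, z⟩, d⟩
    by_cases hy : y = v <;> simp [hy]

/-- Clockwise quarter turn of the `z = v` slice (as seen from positive `z`). -/
def Z {h : ℕ} (v : I h) : Equiv.Perm (S h) where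
  toFun s := if s.1.2.2 = v then ((s.1.2.1, -s.1.1, s.1.2.2), rotZ s.2) else s
  invFun s := if s.1.2.2 = v then ((-s.1.2.1, s.1.1, s.1.2.2), rotZi s.2) else s
  left_inv := by
    rintro ⟨⟨x, y, z⟩, d⟩
    by_cases hz : z = v <;> simp [hz]
  right_inv := by
    rintro ⟨⟨x, y, z⟩, d⟩
    by_cases hz : z = v <;> simp [hz]

/-- The side-length parameter: `h = m + 3n`. -/
abbrev hC (n m : ℕ) : ℕ := m + 3 * n

def bit {m : ℕ} (w : Fin m → Bool) (c : ℤ) : Bool :=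
  if hc : 1 ≤ c ∧ c ≤ (m : ℤ) then w ⟨(c - 1).toNat, by omega⟩ else false

/-- The `x`-slice index corresponding to bit position `j`. -/
def colIdx {n m : ℕ} (j : Fin m) : I (hC n m) :=
  ⟨((j : ℕ) : ℤ) + 1, by
    have hj : (j : ℕ) < m := j.isLt
    constructor
    · omega
    · rw [abs_of_nonneg (by omega)]; push_cast; omega⟩

/-- The `z`-slice index `m + i` corresponding to row `i`. -/
def zIdx {n m : ℕ} (i : Fin n) : I (hC n m) :=
  ⟨(m : ℤ) + ((i : ℕ) : ℤ) + 1, by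
    have hi : (i : ℕ) < n := i.isLt
    constructor
    · omega
    · rw [abs_of_nonneg (by omega)]; push_cast; omega⟩

/-- The face coordinate `h`. -/
def topI {n m : ℕ} (H : 0 < m + 3 * n) : I (hC n m) :=
  ⟨(m : ℤ) + 3 * (n : ℤ), by
    constructor
    · omega
    · rw [abs_of_nonneg (by omega)]; push_cast; omega⟩

/-- `aᵢ := (X 1)^{lᵢ(1)} ⋯ (X m)^{lᵢ(m)}`. -/
def a {n m : ℕ} (l : Fin n → Fin m → Bool) (i : Fin n) : Equiv.Perm (S (hC n m)) :=
  ((List.finRange m).map (fun j => X (colIdx (n := n) j) ^ (if l i j then 1 else 0))).prod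

/-- `bᵢ := aᵢ⁻¹ · (Z (m+i)) · aᵢ`. -/
def b {n m : ℕ} (l : Fin n → Fin m → Bool) (i : Fin n) : Equiv.Perm (S (hC n m)) :=
  (a l i)⁻¹ * Z (zIdx (m := m) i) * a l i

/-- `t := a₁ · b₁ · b₂ ⋯ bₙ`. -/
def t {n m : ℕ} (hn : 0 < n) (l : Fin n → Fin m → Bool) : Equiv.Perm (S (hC n m)) :=
  a l ⟨0, hn⟩ * ((List.finRange n).map (b l)).prod

/-- A slot is a surface slot if its cubie is on the face its direction points to. -/
def IsSurface {h : ℕ} (s : S h) : Prop :=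
  match s.2 with
  | .xp => s.1.1.1 = (h : ℤ)
  | .xn => s.1.1.1 = -(h : ℤ)
  | .yp => s.1.2.1.1 = (h : ℤ)
  | .yn => s.1.2.1.1 = -(h : ℤ)
  | .zp => s.1.2.2.1 = (h : ℤ)
  | .zn => s.1.2.2.1 = -(h : ℤ)

/-- An STM move: a nontrivial rotation of a single slice. -/
def IsSTM {h : ℕ} (g : Equiv.Perm (S h)) : Prop :=
  ∃ (v : I h) (e : ℕ), (e = 1 ∨ e = 2 ∨ e = 3) ∧
    (g = X v ^ e ∨ g = Y v ^ e ∨ g = Z v ^ e)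


theorem colIdx_injective {n m : ℕ} : Function.Injective (colIdx (n := n) (m := m)) := by
  intro j k hjk
  have h := congrArg Subtype.val hjk
  simp only [colIdx] at h
  exact Fin.ext (by omega)

theorem X_apply_self {h : ℕ} (v y z : I h) (d : Dir) :
    X v ((v, y, z), d) = ((v, z, -y), rotX d) := by
  simp [X]

theorem X_apply_of_ne {h : ℕ} {v x : I h} (hx : x ≠ v) (y z : I h) (d : Dir) :
    X v ((x, y, z), d) = ((x, y, z), d) := by
  simp [X, hx]

theorem Z_apply_self {h : ℕ} (v x y : I h) (d : Dir) :
    Z v ((x, y, v), d) = ((y, -x, v), rotZ d) := by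
  simp [Z]

theorem Z_apply_of_ne {h : ℕ} {v z : I h} (hz : z ≠ v) (x y : I h) (d : Dir) :
    Z v ((x, y, z), d) = ((x, y, z), d) := by
  simp [Z, hz]

theorem prod_X_apply_of_ne {n m : ℕ} (w : Fin m → Bool) (L : List (Fin m)) {x : I (hC n m)}
    (hx : ∀ j ∈ L, w j = true → x ≠ colIdx j) (y z : I (hC n m)) (d : Dir) :
    (L.map fun j => X (colIdx (n := n) j) ^ (if w j then 1 else 0)).prod ((x, y, z), d) =
      ((x, y, z), d) := by
  induction L with
  | nil => rfl
  | cons k L ih =>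
    rw [List.map_cons, List.prod_cons, Equiv.Perm.mul_apply,
      ih fun j hj => hx j (List.mem_cons_of_mem k hj)]
    by_cases hk : w k = true
    · simpa [hk] using X_apply_of_ne (hx k List.mem_cons_self hk) y z d
    · simp [hk]

theorem prod_X_apply_of_mem {n m : ℕ} (w : Fin m → Bool) {L : List (Fin m)} (hL : L.Nodup)
    {j : Fin m} (hj : j ∈ L) (hw : w j = true) (y z : I (hC n m)) (d : Dir) :
    (L.map fun j => X (colIdx (n := n) j) ^ (if w j then 1 else 0)).prod
        ((colIdx j, y, z), d) = ((colIdx j, z, -y), rotX d) := by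
  induction L with
  | nil => simp at hj
  | cons k L ih =>
    obtain ⟨hkL, hL⟩ := List.nodup_cons.mp hL
    rw [List.map_cons, List.prod_cons, Equiv.Perm.mul_apply]
    by_cases hjk : j = k
    · subst hjk
      rw [prod_X_apply_of_ne w L fun i hi _ h =>
        ne_of_mem_of_not_mem hi hkL (colIdx_injective h).symm]
      simpa [hw] using X_apply_self (colIdx j) y z d
    · rw [ih hL ((List.mem_cons.mp hj).resolve_left hjk)]
      by_cases hk : w k = true
      · simpa [hk] using X_apply_of_ne (colIdx_injective.ne hjk) z (-y) (rotX d)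
      · simp [hk]

theorem a_apply_of_ne {n m : ℕ} (l : Fin n → Fin m → Bool) (i : Fin n) {x : I (hC n m)}
    (hx : ∀ j, l i j = true → x ≠ colIdx j) (y z : I (hC n m)) (d : Dir) :
    a l i ((x, y, z), d) = ((x, y, z), d) :=
  prod_X_apply_of_ne (l i) _ (fun j _ => hx j) y z d

theorem a_apply_colIdx {n m : ℕ} (l : Fin n → Fin m → Bool) (i : Fin n) {j : Fin m}
    (hj : l i j = true) (y z : I (hC n m)) (d : Dir) :
    a l i ((colIdx j, y, z), d) = ((colIdx j, z, -y), rotX d) :=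
  prod_X_apply_of_mem (l i) (List.nodup_finRange m) (List.mem_finRange j) hj y z d

theorem b_apply_eq_iff {n m : ℕ} (l : Fin n → Fin m → Bool) (i : Fin n) (s s' : S (hC n m)) :
    b l i s = s' ↔ Z (zIdx i) (a l i s) = a l i s' := by
  rw [b, Equiv.Perm.mul_apply, Equiv.Perm.mul_apply, Equiv.Perm.inv_eq_iff_eq]

theorem b_apply_colIdx_neg_zIdx {n m : ℕ} (l : Fin n → Fin m → Bool) (i : Fin n) {j : Fin m}
    (hj : l i j = true) {z : I (hC n m)} (hz : ∀ k, z ≠ colIdx k) (d : Dir) :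
    b l i ((colIdx j, -(zIdx i), z), d) =
      ((z, -(colIdx j), zIdx i), rotZ (rotX d)) := by
  rw [b_apply_eq_iff, a_apply_colIdx l i hj, I.neg_neg, Z_apply_self,
    a_apply_of_ne l i fun k _ => hz k]

theorem b_apply_of_ne {n m : ℕ} (l : Fin n → Fin m → Bool) (i : Fin n) {x y z : I (hC n m)}
    (hz : z ≠ zIdx i) (hxy : ∀ j, l i j = true → x = colIdx j → y ≠ -(zIdx i)) (d : Dir) :
    b l i ((x, y, z), d) = ((x, y, z), d) := by
  rw [b_apply_eq_iff]
  by_cases hx : ∃ j, l i j = true ∧ x = colIdx j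
  · obtain ⟨j, hj, rfl⟩ := hx
    rw [a_apply_colIdx l i hj, Z_apply_of_ne]
    intro hy
    exact hxy j hj rfl (by rw [← hy, I.neg_neg])
  · rw [a_apply_of_ne l i fun j hj h => hx ⟨j, hj, h⟩, Z_apply_of_ne hz]

/-- the effect of `bᵢ` on the `±z` surface slots. -/
theorem stmt_12 (n m : ℕ) (hn : 0 < n) (hm : 0 < m) (l : Fin n → Fin m → Bool)
    (i : Fin n) :
    (∀ j : Fin m, l i j = true →
      b l i ((colIdx (n := n) j, -(zIdx (m := m) i), topI (by omega)), Dir.zp) =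
        ((topI (by omega), -(colIdx (n := n) j), zIdx (m := m) i), Dir.xp) ∧
      b l i ((colIdx (n := n) j, -(zIdx (m := m) i), -(topI (by omega))), Dir.zn) =
        ((-(topI (by omega)), -(colIdx (n := n) j), zIdx (m := m) i), Dir.xn)) ∧
    (∀ s : S (hC n m), IsSurface s → (s.2 = Dir.zp ∨ s.2 = Dir.zn) →
      ¬(∃ j : Fin m, l i j = true ∧
        (s = ((colIdx (n := n) j, -(zIdx (m := m) i), topI (by omega)), Dir.zp) ∨
         s = ((colIdx (n := n) j, -(zIdx (m := m) i), -(topI (by omega))), Dir.zn))) →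
      b l i s = s) := by
  have htop (k : Fin m) : (topI (by omega) : I (hC n m)) ≠ colIdx k := fun h => by
    have h' := congrArg Subtype.val h
    simp only [topI, colIdx] at h'
    omega
  have hbot (k : Fin m) : -(topI (by omega) : I (hC n m)) ≠ colIdx k := fun h => by
    have h' : -((m : ℤ) + 3 * n) = (k : ℕ) + 1 := congrArg Subtype.val h
    omega
  refine ⟨fun j hj => ⟨b_apply_colIdx_neg_zIdx l i hj htop .zp,
    b_apply_colIdx_neg_zIdx l i hj hbot .zn⟩, ?_⟩
  rintro ⟨⟨x, y, z⟩, d⟩ hs hd hne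
  have hi := i.isLt
  obtain rfl | rfl : d = .zp ∨ d = .zn := hd
  · have hz : z.1 = ((m + 3 * n : ℕ) : ℤ) := hs
    refine b_apply_of_ne l i ?_ ?_ _
    · rintro rfl
      simp only [zIdx] at hz
      omega
    · rintro j hj rfl rfl
      have hz' : z = topI (by omega) := Subtype.ext (by rw [hz, topI]; push_cast; rfl)
      exact hne ⟨j, hj, .inl (by rw [hz'])⟩
  · have hz : z.1 = -((m + 3 * n : ℕ) : ℤ) := hs
    refine b_apply_of_ne l i ?_ ?_ _
    · rintro rfl
      simp only [zIdx] at hz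
      omega
    · rintro j hj rfl rfl
      have hz' : z = -(topI (by omega)) :=
        Subtype.ext (hz.trans (show _ = -((m : ℤ) + 3 * n) by push_cast; rfl))
      exact hne ⟨j, hj, .inr (by rw [hz'])⟩

end RC
end

section
/- Let i ∈ {1, …, n}. Then: (1) for every j ∈ I such that it is not the case that 1 ≤ j ≤ m and lᵢ(j) = 1, bᵢ sends the slot ((j, h, m+i), +y) to ((h, −j, m+i), +x) and sends the slot ((j, −h, m+i), −y) to ((−h, −j, m+i), −x); (2) bᵢ fixes every other surface slot whose direction is +y or −y. -/
namespace RC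

theorem X_apply {h : ℕ} (v x y z : I h) (d : Dir) :
    X v ((x, y, z), d) = if x = v then ((x, z, -y), rotX d) else ((x, y, z), d) := rfl

theorem Z_apply {h : ℕ} (v x y z : I h) (d : Dir) :
    Z v ((x, y, z), d) = if z = v then ((y, -x, z), rotZ d) else ((x, y, z), d) := rfl

theorem bit_eq_true_iff {n m : ℕ} (w : Fin m → Bool) (x : I (hC n m)) :
    bit w x.1 = true ↔ ∃ j, w j = true ∧ x = colIdx j := by
  unfold bit
  constructor
  · intro hw
    split_ifs at hw with hc
    refine ⟨_, hw, Subtype.ext ?_⟩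
    simp only [colIdx]
    omega
  · rintro ⟨j, hj, rfl⟩
    have hlt := j.isLt
    rw [dif_pos (by simp only [colIdx]; omega)]
    rw [← hj]
    congr 1
    exact Fin.ext (by simp [colIdx])

theorem bit_eq_false_of_lt {m : ℕ} (w : Fin m → Bool) {c : ℤ} (hc : (m : ℤ) < c) :
    bit w c = false :=
  dif_neg (by omega)

theorem bit_eq_false_of_neg {m : ℕ} (w : Fin m → Bool) {c : ℤ} (hc : c < 0) :
    bit w c = false :=
  dif_neg (by omega)

open Classical in
theorem prod_X_pow_apply {n m : ℕ} (w : Fin m → Bool) (L : List (Fin m)) (hL : L.Nodup)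
    (x y z : I (hC n m)) (d : Dir) :
    (L.map fun j => X (colIdx (n := n) j) ^ (if w j then 1 else 0)).prod ((x, y, z), d) =
      if ∃ j ∈ L, w j = true ∧ x = colIdx j then ((x, z, -y), rotX d) else ((x, y, z), d) := by
  induction L with
  | nil => simp
  | cons k L ih =>
    obtain ⟨hk, hL⟩ := List.nodup_cons.mp hL
    rw [List.map_cons, List.prod_cons, Equiv.Perm.mul_apply, ih hL]
    by_cases hkx : w k = true ∧ x = colIdx k
    · have hne : ¬ ∃ j ∈ L, w j = true ∧ x = colIdx j := by
        rintro ⟨j, hj, -, hjx⟩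
        exact hk (colIdx_injective (hjx.symm.trans hkx.2) ▸ hj)
      rw [if_neg hne, if_pos hkx.1, pow_one, X_apply, if_pos hkx.2,
        if_pos ⟨k, List.mem_cons_self, hkx⟩]
    · have hfix : ∀ y z d, (X (colIdx (n := n) k) ^ (if w k then 1 else 0)) ((x, y, z), d) =
          ((x, y, z), d) := by
        intro y z d
        by_cases hwk : w k = true
        · rw [if_pos hwk, pow_one, X_apply, if_neg fun hx => hkx ⟨hwk, hx⟩]
        · rw [if_neg hwk, pow_zero, Equiv.Perm.one_apply]
      have hiff : (∃ j ∈ k :: L, w j = true ∧ x = colIdx j) ↔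
          ∃ j ∈ L, w j = true ∧ x = colIdx j := by
        simp [hkx]
      simp only [hiff]
      by_cases hL' : ∃ j ∈ L, w j = true ∧ x = colIdx j
      · simp only [if_pos hL', hfix]
      · simp only [if_neg hL', hfix]

theorem a_apply {n m : ℕ} (l : Fin n → Fin m → Bool) (i : Fin n) (x y z : I (hC n m)) (d : Dir) :
    a l i ((x, y, z), d) =
      if bit (l i) x.1 = true then ((x, z, -y), rotX d) else ((x, y, z), d) := by
  rw [a, prod_X_pow_apply (l i) _ (List.nodup_finRange m)]
  simp only [bit_eq_true_iff, List.mem_finRange, true_and]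

theorem a_apply_of_bit_eq_false {n m : ℕ} (l : Fin n → Fin m → Bool) (i : Fin n)
    {x : I (hC n m)} (hx : bit (l i) x.1 = false) (y z : I (hC n m)) (d : Dir) :
    a l i ((x, y, z), d) = ((x, y, z), d) := by
  simp [a_apply, hx]

/-- A slot whose image under `aᵢ` avoids the slice turned by `Z (m+i)` is fixed by `bᵢ`. -/
theorem b_apply_eq_self {n m : ℕ} (l : Fin n → Fin m → Bool) (i : Fin n) (s : S (hC n m))
    (hs : (a l i s).1.2.2 ≠ zIdx i) : b l i s = s := by
  rw [b, Equiv.Perm.mul_apply, Equiv.Perm.mul_apply, Equiv.Perm.inv_eq_iff_eq]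
  exact if_neg hs

theorem b_apply_of_bit_eq_false {n m : ℕ} (l : Fin n → Fin m → Bool) (i : Fin n)
    {x y : I (hC n m)} (hx : bit (l i) x.1 = false) (hy : bit (l i) y.1 = false) (d : Dir) :
    b l i ((x, y, zIdx i), d) = ((y, -x, zIdx i), rotZ d) := by
  rw [b, Equiv.Perm.mul_apply, Equiv.Perm.mul_apply, a_apply_of_bit_eq_false l i hx, Z_apply,
    if_pos rfl, Equiv.Perm.inv_eq_iff_eq, a_apply_of_bit_eq_false l i hy]

theorem bit_topI {n m : ℕ} (hn : 0 < n) (H : 0 < m + 3 * n) (w : Fin m → Bool) :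
    bit w (topI H : I (hC n m)).1 = false :=
  bit_eq_false_of_lt w (by simp only [topI]; omega)

theorem bit_neg_topI {n m : ℕ} (H : 0 < m + 3 * n) (w : Fin m → Bool) :
    bit w (-topI H : I (hC n m)).1 = false :=
  bit_eq_false_of_neg w (by change -((m : ℤ) + 3 * n) < 0; omega)

theorem topI_ne_zIdx {n m : ℕ} (H : 0 < m + 3 * n) (i : Fin n) :
    topI H ≠ zIdx (m := m) i := by
  intro h
  have := congrArg Subtype.val h
  simp only [topI, zIdx] at this
  omega

theorem neg_topI_ne_zIdx {n m : ℕ} (H : 0 < m + 3 * n) (i : Fin n) :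
    -topI H ≠ zIdx (m := m) i := by
  intro h
  have : -((m : ℤ) + 3 * n) = m + (i : ℕ) + 1 := congrArg Subtype.val h
  omega

/-- the effect of `bᵢ` on the `±y` surface slots. -/
theorem stmt_13 (n m : ℕ) (hn : 0 < n) (hm : 0 < m) (l : Fin n → Fin m → Bool)
    (i : Fin n) :
    (∀ j : I (hC n m), bit (l i) j.1 = false →
      b l i ((j, topI (by omega), zIdx (m := m) i), Dir.yp) =
        ((topI (by omega), -j, zIdx (m := m) i), Dir.xp) ∧
      b l i ((j, -(topI (by omega)), zIdx (m := m) i), Dir.yn) =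
        ((-(topI (by omega)), -j, zIdx (m := m) i), Dir.xn)) ∧
    (∀ s : S (hC n m), IsSurface s → (s.2 = Dir.yp ∨ s.2 = Dir.yn) →
      ¬(∃ j : I (hC n m), bit (l i) j.1 = false ∧
        (s = ((j, topI (by omega), zIdx (m := m) i), Dir.yp) ∨
         s = ((j, -(topI (by omega)), zIdx (m := m) i), Dir.yn))) →
      b l i s = s) := by
  have H : 0 < m + 3 * n := by omega
  refine ⟨fun j hj => ⟨b_apply_of_bit_eq_false l i hj (bit_topI hn H _) _,
    b_apply_of_bit_eq_false l i hj (bit_neg_topI H _) _⟩, ?_⟩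
  rintro ⟨⟨x, y, z⟩, d⟩ hs hd hne
  have hcases : (y = topI H ∧ d = Dir.yp) ∨ (y = -topI H ∧ d = Dir.yn) := by
    rcases hd with rfl | rfl
    · refine Or.inl ⟨Subtype.ext (Eq.trans hs ?_), rfl⟩
      simp [topI]
    · refine Or.inr ⟨Subtype.ext (Eq.trans hs ?_), rfl⟩
      change -((m + 3 * n : ℕ) : ℤ) = -((m : ℤ) + 3 * n)
      push_cast
      rfl
  apply b_apply_eq_self
  rw [a_apply]
  split_ifs with hx
  · rcases hcases with ⟨rfl, -⟩ | ⟨rfl, -⟩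
    · exact neg_topI_ne_zIdx H i
    · rw [I.neg_neg]
      exact topI_ne_zIdx H i
  · rintro rfl
    refine hne ⟨x, by simpa using hx, ?_⟩
    rcases hcases with ⟨rfl, rfl⟩ | ⟨rfl, rfl⟩
    · exact Or.inl rfl
    · exact Or.inr rfl

end RC
end
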